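/- Let N ≥ 1, θ > 0, and let h_θ : (0,∞)^N → ℝ be a C² strictly convex function satisfying Hypothesis (H6a) and the uniform convexity bound (LMB21) with constant K > 0. Then the convex conjugate h*_θ is twice differentiable, its Hessian at μ ∈ ℝ^N equals the inverse of the Hessian of h_θ at ρ = ∇h*_θ(μ), i.e. ∇²h*_θ(μ) = (∇²h_θ(∇h*_θ(μ)))^{-1}, and for every R > 0: if ρ̄ = Σ_{i=1}^N ∂h*_θ/∂μ_i(μ) ≤ R, then the symmetric positive definite matrix ∇²h*_θ(μ) has all eigenvalues at most R/(Kθ); in particular every entry satisfies |∂²h*_θ/∂μ_i∂μ_j(μ)| ≤ R/(Kθ). -/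

import Mathlib

open Filter Topology MeasureTheory Matrix

noncomputable section

/-- The positive orthant `(0,∞)^N`. -/
def posOrth (N : ℕ) : Set (Fin N → ℝ) := {ρ | ∀ i, 0 < ρ i}

/-- Total density `ρ̄ = ∑ᵢ ρᵢ`. -/
def rbar {N : ℕ} (ρ : Fin N → ℝ) : ℝ := ∑ i, ρ i

/-- Gradient: the vector of partial derivatives. -/
def pgrad {N : ℕ} (h : (Fin N → ℝ) → ℝ) (ρ : Fin N → ℝ) : Fin N → ℝ :=
  fun i => fderiv ℝ h ρ (Pi.single i 1)

/-- Hessian matrix of second partial derivatives. -/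
def phess {N : ℕ} (h : (Fin N → ℝ) → ℝ) (ρ : Fin N → ℝ) : Matrix (Fin N) (Fin N) ℝ :=
  Matrix.of fun i j => fderiv ℝ (fun x => pgrad h x j) ρ (Pi.single i 1)

/-- Hypothesis (H6a): `h(ρ) → 0` and `∇h(ρ)·ρ → 0` as `ρ̄ → 0⁺`, `h(ρ)/ρ̄ → ∞` as
`ρ̄ → ∞`, and for each `i` and `R > 0`, `sup_{ρⱼ ∈ (0,R), j ≠ i} ∂h/∂ρᵢ(ρ) → -∞`
as `ρᵢ → 0⁺`. -/
def H6a {N : ℕ} (h : (Fin N → ℝ) → ℝ) : Prop :=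
  Tendsto h (𝓟 (posOrth N) ⊓ Filter.comap (rbar (N := N)) (𝓝[>] (0:ℝ))) (𝓝 0) ∧
  Tendsto (fun ρ : Fin N → ℝ => ∑ i, pgrad h ρ i * ρ i)
      (𝓟 (posOrth N) ⊓ Filter.comap (rbar (N := N)) (𝓝[>] (0:ℝ))) (𝓝 0) ∧
  Tendsto (fun ρ : Fin N → ℝ => h ρ / rbar ρ)
      (𝓟 (posOrth N) ⊓ Filter.comap (rbar (N := N)) atTop) atTop ∧
  ∀ i : Fin N, ∀ R > (0:ℝ), ∀ M : ℝ, ∃ ε > (0:ℝ), ∀ ρ ∈ posOrth N,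
    ρ i < ε → (∀ j, j ≠ i → ρ j < R) → pgrad h ρ i < M

/-- The convex conjugate (Legendre transform) `h*(μ) = sup_{ρ ∈ (0,∞)^N} (μ·ρ - h(ρ))`. -/
def hstar {N : ℕ} (h : (Fin N → ℝ) → ℝ) (μ : Fin N → ℝ) : ℝ :=
  sSup ((fun ρ => (∑ i, μ i * ρ i) - h ρ) '' posOrth N)

/-- The uniform convexity bound (LMB21): `∇²h(ρ)x·x ≥ (Kθ/ρ̄)|x|²`. -/
def LMB21 {N : ℕ} (h : (Fin N → ℝ) → ℝ) (θ K : ℝ) : Prop :=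
  ∀ ρ ∈ posOrth N, ∀ x : Fin N → ℝ,
    K * θ / rbar ρ * (∑ i, x i ^ 2) ≤ ∑ i, ∑ j, phess h ρ i j * x i * x j

lemma isOpen_posOrth (N : ℕ) : IsOpen (posOrth N) := by
  have : posOrth N = Set.univ.pi fun _ => Set.Ioi 0 := by ext; simp [posOrth]
  rw [this]
  exact isOpen_set_pi Set.finite_univ fun _ _ => isOpen_Ioi

lemma convex_posOrth (N : ℕ) : Convex ℝ (posOrth N) := by
  have : posOrth N = Set.univ.pi fun _ => Set.Ioi 0 := by ext; simp [posOrth]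
  rw [this]
  exact convex_pi fun _ _ => convex_Ioi 0

lemma rbar_pos {N : ℕ} (hN : 1 ≤ N) {ρ : Fin N → ℝ} (hρ : ρ ∈ posOrth N) : 0 < rbar ρ :=
  Finset.sum_pos (fun i _ => hρ i) ⟨⟨0, hN⟩, Finset.mem_univ _⟩

lemma le_rbar {N : ℕ} {ρ : Fin N → ℝ} (hρ : ρ ∈ posOrth N) (i : Fin N) : ρ i ≤ rbar ρ :=
  Finset.single_le_sum (f := ρ) (fun j _ => (hρ j).le) (Finset.mem_univ i)

lemma clm_apply_eq_dotProduct {N : ℕ} (L : (Fin N → ℝ) →L[ℝ] ℝ) (v : Fin N → ℝ) :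
    L v = (fun i => L (Pi.single i 1)) ⬝ᵥ v := by
  conv_lhs => rw [← Finset.univ_sum_single v, map_sum]
  refine Finset.sum_congr rfl fun i _ => ?_
  rw [show Pi.single i (v i) = v i • (Pi.single i 1 : Fin N → ℝ) by
    rw [← Pi.single_smul, smul_eq_mul, mul_one], map_smul, smul_eq_mul, mul_comm]

lemma fderiv_apply_eq_dotProduct {N : ℕ} (h : (Fin N → ℝ) → ℝ) (ρ v : Fin N → ℝ) :
    fderiv ℝ h ρ v = pgrad h ρ ⬝ᵥ v :=
  clm_apply_eq_dotProduct _ v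

/-- A differentiable convex function lies above its tangent hyperplanes. -/
lemma ConvexOn.add_fderiv_le {E : Type*} [NormedAddCommGroup E] [NormedSpace ℝ E] {s : Set E}
    {f : E → ℝ} (hf : ConvexOn ℝ s f) {x y : E} (hx : x ∈ s) (hy : y ∈ s)
    (hd : DifferentiableAt ℝ f x) : f x + fderiv ℝ f x (y - x) ≤ f y := by
  have hc := hf.comp_affineMap (AffineMap.lineMap x y : ℝ →ᵃ[ℝ] E)
  have hl : HasDerivAt (AffineMap.lineMap x y : ℝ → E) (y - x) 0 :=
    AffineMap.hasDerivAt_lineMap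
  have hfd : HasFDerivAt f (fderiv ℝ f x) ((AffineMap.lineMap x y : ℝ → E) 0) := by
    simpa using hd.hasFDerivAt
  have := hc.le_slope_of_hasDerivAt (x := 0) (y := 1) (by simpa using hx) (by simpa using hy)
    one_pos (hfd.comp_hasDerivAt 0 hl)
  simp [slope_def_field] at this
  rw [map_sub]
  linarith

lemma contDiffAt_pgrad {N : ℕ} {h : (Fin N → ℝ) → ℝ} {ρ : Fin N → ℝ}
    (hh : ContDiffAt ℝ 2 h ρ) : ContDiffAt ℝ 1 (pgrad h) ρ := by
  refine contDiffAt_pi.2 fun i => ?_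
  exact (hh.fderiv_right (m := 1) (by norm_num)).clm_apply contDiffAt_const

lemma fderiv_pgrad {N : ℕ} {h : (Fin N → ℝ) → ℝ} {ρ : Fin N → ℝ}
    (hh : DifferentiableAt ℝ (pgrad h) ρ) (v : Fin N → ℝ) :
    fderiv ℝ (pgrad h) ρ v = (phess h ρ)ᵀ *ᵥ v := by
  ext j
  have hj := (hasFDerivAt_pi'.1 hh.hasFDerivAt j).fderiv
  change (ContinuousLinearMap.proj (R := ℝ) j ∘SL fderiv ℝ (pgrad h) ρ) v = _
  rw [← hj, clm_apply_eq_dotProduct]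
  rfl

lemma phess_isSymm {N : ℕ} {h : (Fin N → ℝ) → ℝ} {ρ : Fin N → ℝ}
    (hh : ContDiffAt ℝ 2 h ρ) : (phess h ρ).IsSymm := by
  have hs := hh.isSymmSndFDerivAt (by simp)
  have hd : DifferentiableAt ℝ (fderiv ℝ h) ρ :=
    (hh.fderiv_right (m := 1) (by norm_num)).differentiableAt (by norm_num)
  have key (i j : Fin N) : phess h ρ i j
      = fderiv ℝ (fderiv ℝ h) ρ (Pi.single i 1) (Pi.single j 1) := by
    simp only [phess, pgrad, Matrix.of_apply]
    rw [fderiv_clm_apply hd (differentiableAt_const _)]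
    simp
  ext i j
  rw [Matrix.transpose_apply, key, key]
  exact hs _ _

lemma sum_sum_mul_eq_dotProduct_mulVec {N : ℕ} (A : Matrix (Fin N) (Fin N) ℝ) (x : Fin N → ℝ) :
    ∑ i, ∑ j, A i j * x i * x j = x ⬝ᵥ A *ᵥ x := by
  simp only [dotProduct, mulVec, Finset.mul_sum]
  exact Finset.sum_congr rfl fun i _ => Finset.sum_congr rfl fun j _ => by ring

/-- `h - μ ·` attains its minimum over the open positive orthant. -/
lemma exists_isMinOn_sub_dotProduct {N : ℕ} {h : (Fin N → ℝ) → ℝ}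
    (hd : DifferentiableOn ℝ h (posOrth N)) (hconv : ConvexOn ℝ (posOrth N) h)
    (hH6 : H6a h) (μ : Fin N → ℝ) :
    ∃ ρ ∈ posOrth N, IsMinOn (fun σ => h σ - μ ⬝ᵥ σ) (posOrth N) ρ := by
  obtain ⟨-, -, hsup, hbd⟩ := hH6
  set f : (Fin N → ℝ) → ℝ := fun σ => h σ - μ ⬝ᵥ σ
  set M : ℝ := ∑ i, |μ i| + |f 1| with hM
  obtain ⟨R, hR1, hR⟩ : ∃ R : ℝ, 1 < R ∧ ∀ ρ ∈ posOrth N, R ≤ rbar ρ → f 1 ≤ f ρ := by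
    have h1 := hsup.eventually (eventually_ge_atTop M)
    rw [inf_comm, Filter.eventually_inf_principal, Filter.eventually_comap] at h1
    obtain ⟨R₀, hR₀⟩ := Filter.eventually_atTop.1 h1
    refine ⟨max R₀ 2, lt_max_of_lt_right one_lt_two, fun ρ hρ hle => ?_⟩
    have hb1 : 1 ≤ rbar ρ := by linarith [le_max_right R₀ 2]
    have h2 := hR₀ _ ((le_max_left _ _).trans hle) ρ rfl hρ
    rw [le_div_iff₀ (by linarith)] at h2
    have h3 : μ ⬝ᵥ ρ ≤ (∑ i, |μ i|) * rbar ρ := by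
      rw [Finset.sum_mul]
      refine Finset.sum_le_sum fun i _ => ?_
      exact mul_le_mul (le_abs_self _) (le_rbar hρ i) (hρ i).le (abs_nonneg _)
    have h4 : |f 1| ≤ |f 1| * rbar ρ := le_mul_of_one_le_right (abs_nonneg _) hb1
    have h5 := le_abs_self (f 1)
    change f 1 ≤ h ρ - μ ⬝ᵥ ρ
    rw [hM, add_mul] at h2
    linarith
  choose ε hε0 hε using fun i => hbd i R (by linarith) (μ i)
  obtain ⟨δ, hδ0, hδ1, hδ⟩ : ∃ δ : ℝ, 0 < δ ∧ δ < 1 ∧ ∀ i, δ < ε i := by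
    have : ∀ᶠ δ in 𝓝[>] (0 : ℝ), 0 < δ ∧ δ < 1 ∧ ∀ i, δ < ε i := by
      refine eventually_mem_nhdsWithin.and (Filter.Eventually.and ?_ ?_)
      · exact nhdsWithin_le_nhds (eventually_lt_nhds one_pos)
      · exact Filter.eventually_all.2 fun i => nhdsWithin_le_nhds (eventually_lt_nhds (hε0 i))
    exact this.exists
  set B : Set (Fin N → ℝ) := Set.Icc (fun _ => δ) (fun _ => R)
  have hBpos : B ⊆ posOrth N := fun ρ hρ i => hδ0.trans_le (hρ.1 i)
  have honeB : (1 : Fin N → ℝ) ∈ B := ⟨fun _ => hδ1.le, fun _ => hR1.le⟩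
  have hfc : ContinuousOn f B := by
    refine (hd.continuousOn.mono hBpos).sub (Continuous.continuousOn ?_)
    exact Continuous.dotProduct continuous_const continuous_id
  obtain ⟨ρ, hρB, hρ⟩ := isCompact_Icc.exists_isMinOn ⟨_, honeB⟩ hfc
  refine ⟨ρ, hBpos hρB, fun σ hσ => ?_⟩
  change f ρ ≤ f σ
  by_cases hσR : R ≤ rbar σ
  · exact (hρ honeB).trans (hR σ hσ hσR)
  have hσlt (i) : σ i < R := (le_rbar hσ i).trans_lt (not_le.1 hσR)
  set τ : Fin N → ℝ := fun i => max (σ i) δ with hτ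
  have hτlt (i) : τ i < R := max_lt (hσlt i) (by linarith)
  have hτB : τ ∈ B := ⟨fun i => le_max_right _ _, fun i => (hτlt i).le⟩
  refine (hρ hτB).trans ?_
  have hgrad := hconv.add_fderiv_le (hBpos hτB) hσ
    (hd.differentiableAt ((isOpen_posOrth N).mem_nhds (hBpos hτB)))
  rw [fderiv_apply_eq_dotProduct] at hgrad
  have hnn : 0 ≤ (pgrad h τ - μ) ⬝ᵥ (σ - τ) := by
    refine Finset.sum_nonneg fun i _ => ?_
    rcases le_or_gt δ (σ i) with hi | hi
    · simp [hτ, max_eq_left hi]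
    · have hτi : τ i = δ := max_eq_right hi.le
      refine mul_nonneg_of_nonpos_of_nonpos ?_ ?_
      · have := hε i τ (hBpos hτB) (hτi ▸ hδ i) fun j _ => hτlt j
        simpa using this.le
      · simpa [hτi] using hi.le
  rw [sub_dotProduct, dotProduct_sub μ] at hnn
  change h τ - μ ⬝ᵥ τ ≤ h σ - μ ⬝ᵥ σ
  linarith

/-- The gradient of `h` maps the positive orthant onto `ℝ^N`. -/
lemma exists_pgrad_eq {N : ℕ} {h : (Fin N → ℝ) → ℝ}
    (hd : DifferentiableOn ℝ h (posOrth N)) (hconv : ConvexOn ℝ (posOrth N) h)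
    (hH6 : H6a h) (μ : Fin N → ℝ) :
    ∃ ρ ∈ posOrth N, pgrad h ρ = μ := by
  obtain ⟨ρ, hρ, hmin⟩ := exists_isMinOn_sub_dotProduct hd hconv hH6 μ
  refine ⟨ρ, hρ, ?_⟩
  have hnhds := (isOpen_posOrth N).mem_nhds hρ
  let L : (Fin N → ℝ) →L[ℝ] ℝ := LinearMap.toContinuousLinearMap (dotProductBilin ℝ ℝ μ)
  have h0 := (hmin.isLocalMin hnhds).hasFDerivAt_eq_zero
    ((hd.differentiableAt hnhds).hasFDerivAt.sub L.hasFDerivAt)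
  ext i
  have := congrArg (fun T => T (Pi.single i 1)) h0
  simp [L, sub_eq_zero] at this
  exact this

lemma isMinOn_of_pgrad_eq {N : ℕ} {h : (Fin N → ℝ) → ℝ}
    (hd : DifferentiableOn ℝ h (posOrth N)) (hconv : ConvexOn ℝ (posOrth N) h)
    {ρ : Fin N → ℝ} (hρ : ρ ∈ posOrth N) :
    IsMinOn (fun σ => h σ - pgrad h ρ ⬝ᵥ σ) (posOrth N) ρ := by
  intro σ hσ
  have := hconv.add_fderiv_le hρ hσ (hd.differentiableAt ((isOpen_posOrth N).mem_nhds hρ))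
  rw [fderiv_apply_eq_dotProduct, dotProduct_sub] at this
  change h ρ - pgrad h ρ ⬝ᵥ ρ ≤ h σ - pgrad h ρ ⬝ᵥ σ
  linarith

lemma injOn_pgrad {N : ℕ} {h : (Fin N → ℝ) → ℝ}
    (hd : DifferentiableOn ℝ h (posOrth N)) (hSC : StrictConvexOn ℝ (posOrth N) h) :
    Set.InjOn (pgrad h) (posOrth N) := by
  intro ρ hρ σ hσ heq
  have hsc : StrictConvexOn ℝ (posOrth N) (fun τ => h τ - pgrad h ρ ⬝ᵥ τ) :=
    hSC.sub_concaveOn ((dotProductBilin ℝ ℝ (pgrad h ρ)).concaveOn (convex_posOrth N))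
  exact hsc.eq_of_isMinOn (isMinOn_of_pgrad_eq hd hSC.convexOn hρ)
    (heq ▸ isMinOn_of_pgrad_eq hd hSC.convexOn hσ) hρ hσ

lemma hstar_pgrad {N : ℕ} {h : (Fin N → ℝ) → ℝ}
    (hd : DifferentiableOn ℝ h (posOrth N)) (hconv : ConvexOn ℝ (posOrth N) h)
    {ρ : Fin N → ℝ} (hρ : ρ ∈ posOrth N) :
    hstar h (pgrad h ρ) = pgrad h ρ ⬝ᵥ ρ - h ρ := by
  refine IsGreatest.csSup_eq ⟨⟨ρ, hρ, rfl⟩, ?_⟩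
  rintro _ ⟨σ, hσ, rfl⟩
  have : h ρ - pgrad h ρ ⬝ᵥ ρ ≤ h σ - pgrad h ρ ⬝ᵥ σ := isMinOn_of_pgrad_eq hd hconv hρ hσ
  change pgrad h ρ ⬝ᵥ σ - h σ ≤ _
  linarith

/-- A right inverse of the gradient with values in the positive orthant is `C¹` wherever the
Hessian is nondegenerate. -/
lemma contDiffAt_of_pgrad_rightInverse {N : ℕ} {h : (Fin N → ℝ) → ℝ}
    (hC2 : ContDiffOn ℝ 2 h (posOrth N)) (hinj : Set.InjOn (pgrad h) (posOrth N))
    {r : (Fin N → ℝ) → Fin N → ℝ} (hr : ∀ μ, r μ ∈ posOrth N) (hgr : ∀ μ, pgrad h (r μ) = μ)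
    {μ : Fin N → ℝ} (hdet : IsUnit (phess h (r μ))) : ContDiffAt ℝ 1 r μ := by
  have hnhds := (isOpen_posOrth N).mem_nhds (hr μ)
  have hG := contDiffAt_pgrad (hC2.contDiffAt hnhds)
  have hGd := hG.differentiableAt one_ne_zero
  have hinjD : Function.Injective (fderiv ℝ (pgrad h) (r μ)) := by
    have : ⇑(fderiv ℝ (pgrad h) (r μ)) = (phess h (r μ))ᵀ.mulVec := funext (fderiv_pgrad hGd)
    rw [this]
    exact Matrix.mulVec_injective_of_isUnit ((Matrix.isUnit_transpose _).2 hdet)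
  let e : (Fin N → ℝ) ≃L[ℝ] (Fin N → ℝ) := (LinearEquiv.ofInjectiveEndo
    (fderiv ℝ (pgrad h) (r μ)).toLinearMap hinjD).toContinuousLinearEquiv
  have he : HasFDerivAt (pgrad h) (e : (Fin N → ℝ) →L[ℝ] (Fin N → ℝ)) (r μ) := by
    refine hGd.hasFDerivAt.congr_fderiv ?_
    ext1 v
    rfl
  have hloc := hG.to_localInverse he one_ne_zero
  have hright := (hG.hasStrictFDerivAt' he one_ne_zero).eventually_right_inverse
  have hval := hG.localInverse_apply_image he one_ne_zero
  rw [hgr] at hloc hright hval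
  refine hloc.congr_of_eventuallyEq ?_
  filter_upwards [hright, hloc.continuousAt.eventually (by rw [hval]; exact hnhds)] with ν h1 h2
  exact hinj (hr ν) h2 ((hgr ν).trans h1.symm)

lemma hasFDerivAt_conjugate {N : ℕ} {h : (Fin N → ℝ) → ℝ} {r : (Fin N → ℝ) → Fin N → ℝ}
    {μ : Fin N → ℝ} (hd : DifferentiableAt ℝ h (r μ)) (hr : DifferentiableAt ℝ r μ)
    (hgr : pgrad h (r μ) = μ) :
    HasFDerivAt (fun ν => ν ⬝ᵥ r ν - h (r ν))
      (LinearMap.toContinuousLinearMap (dotProductBilin ℝ ℝ (r μ))) μ := by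
  have h1 : HasFDerivAt (fun ν : Fin N → ℝ => ν ⬝ᵥ r ν) _ μ :=
    HasFDerivAt.fun_sum fun i _ =>
      (hasFDerivAt_apply (𝕜 := ℝ) i μ).mul (hasFDerivAt_pi'.1 hr.hasFDerivAt i)
  refine (h1.sub (hd.hasFDerivAt.comp μ hr.hasFDerivAt)).congr_fderiv ?_
  ext1 v
  simp [fderiv_apply_eq_dotProduct, hgr, dotProduct, Finset.sum_add_distrib]

lemma pgrad_eq_of_hasFDerivAt {N : ℕ} {h : (Fin N → ℝ) → ℝ} {ρ μ : Fin N → ℝ}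
    (hh : HasFDerivAt h (LinearMap.toContinuousLinearMap (dotProductBilin ℝ ℝ ρ)) μ) :
    pgrad h μ = ρ := by
  ext i
  simp [pgrad, hh.fderiv]

lemma contDiff_two_of_pgrad {N : ℕ} {h : (Fin N → ℝ) → ℝ} (hd : Differentiable ℝ h)
    (hg : ContDiff ℝ 1 (pgrad h)) : ContDiff ℝ 2 h := by
  rw [← one_add_one_eq_two, contDiff_succ_iff_fderiv]
  refine ⟨hd, by simp, contDiff_clm_apply_iff.2 fun v => ?_⟩
  simp only [fderiv_apply_eq_dotProduct]
  exact ContDiff.sum fun i _ => (contDiff_pi.1 hg i).mul contDiff_const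

lemma posDef_of_mul_dotProduct_le {N : ℕ} {A : Matrix (Fin N) (Fin N) ℝ} (hA : A.IsSymm) {c : ℝ}
    (hc : 0 < c) (hle : ∀ x, c * (x ⬝ᵥ x) ≤ x ⬝ᵥ A *ᵥ x) : A.PosDef := by
  refine Matrix.PosDef.of_dotProduct_mulVec_pos (by simpa [IsHermitian, IsSymm] using hA) fun x hx => ?_
  have : 0 < x ⬝ᵥ x := by simpa using dotProduct_star_self_pos_iff.2 hx
  exact (mul_pos hc this).trans_le (by simpa using hle x)

/-- If a quadratic form is bounded below by `c`, its inverse is bounded above by `1 / c`. -/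
lemma mul_dotProduct_mulVec_le_of_mul_eq_one {N : ℕ} {A B : Matrix (Fin N) (Fin N) ℝ} {c : ℝ}
    (hc : 0 < c) (hle : ∀ x, c * (x ⬝ᵥ x) ≤ x ⬝ᵥ A *ᵥ x) (hAB : A * B = 1) (x : Fin N → ℝ) :
    c * (x ⬝ᵥ B *ᵥ x) ≤ x ⬝ᵥ x := by
  have h1 := hle (B *ᵥ x)
  rw [mulVec_mulVec, hAB, one_mulVec, dotProduct_comm _ x] at h1
  have h2 : 0 ≤ (x - c • (B *ᵥ x)) ⬝ᵥ (x - c • (B *ᵥ x)) := by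
    simpa using dotProduct_star_self_nonneg (x - c • (B *ᵥ x))
  simp only [sub_dotProduct, dotProduct_sub, smul_dotProduct, dotProduct_smul, smul_eq_mul,
    dotProduct_comm (B *ᵥ x) x] at h2
  nlinarith

lemma abs_apply_le_of_dotProduct_mulVec_le {N : ℕ} {B : Matrix (Fin N) (Fin N) ℝ}
    (hB : B.PosSemidef) {L : ℝ} (hle : ∀ x, x ⬝ᵥ B *ᵥ x ≤ L * (x ⬝ᵥ x)) (i j : Fin N) :
    |B i j| ≤ L := by
  have hsymm : B j i = B i j := by simpa using hB.isHermitian.apply i j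
  have hdiag (k : Fin N) : B k k ≤ L := by simpa using hle (Pi.single k 1)
  have h1 : (0 : ℝ) ≤ _ := hB.dotProduct_mulVec_nonneg (Pi.single i 1 + Pi.single j 1)
  have h2 : (0 : ℝ) ≤ _ := hB.dotProduct_mulVec_nonneg (Pi.single i 1 - Pi.single j 1)
  simp [mulVec_add, mulVec_sub, hsymm] at h1 h2
  rw [abs_le]
  constructor <;> linarith [hdiag i, hdiag j]

/-- Under (H6a) and the uniform convexity bound (LMB21) with
constant `K > 0`, the conjugate `h*` is twice differentiable, its Hessian at `μ` is
the inverse of the Hessian of `h` at `ρ = ∇h*(μ)`, and whenever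
`ρ̄ = ∑ᵢ ∂h*/∂μᵢ(μ) ≤ R` the symmetric positive definite matrix `∇²h*(μ)` has all
eigenvalues at most `R/(Kθ)`; in particular all its entries are at most `R/(Kθ)` in
absolute value. -/
theorem stmt1 (N : ℕ) (hN : 1 ≤ N) (θ K : ℝ) (hθ : 0 < θ) (hK : 0 < K)
    (h : (Fin N → ℝ) → ℝ)
    (hC2 : ContDiffOn ℝ 2 h (posOrth N))
    (hSC : StrictConvexOn ℝ (posOrth N) h)
    (hH6 : H6a h)
    (hLMB : LMB21 h θ K) :
    ContDiff ℝ 2 (hstar h) ∧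
    (∀ μ : Fin N → ℝ,
      phess h (pgrad (hstar h) μ) * phess (hstar h) μ = 1 ∧
      phess (hstar h) μ * phess h (pgrad (hstar h) μ) = 1 ∧
      (phess (hstar h) μ).IsSymm ∧ (phess (hstar h) μ).PosDef) ∧
    (∀ R > (0:ℝ), ∀ μ : Fin N → ℝ, rbar (pgrad (hstar h) μ) ≤ R →
      (∀ x : Fin N → ℝ,
        ∑ i, ∑ j, phess (hstar h) μ i j * x i * x j ≤ R / (K * θ) * ∑ i, x i ^ 2) ∧
      (∀ i j, |phess (hstar h) μ i j| ≤ R / (K * θ))) := by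

  have hd : DifferentiableOn ℝ h (posOrth N) := hC2.differentiableOn two_ne_zero
  have hconv := hSC.convexOn
  choose r hr hgr using exists_pgrad_eq hd hconv hH6
  have hC2at (μ) : ContDiffAt ℝ 2 h (r μ) := hC2.contDiffAt ((isOpen_posOrth N).mem_nhds (hr μ))
  have hcpos (μ) : 0 < K * θ / rbar (r μ) := div_pos (mul_pos hK hθ) (rbar_pos hN (hr μ))
  have hlow (μ x) : K * θ / rbar (r μ) * (x ⬝ᵥ x) ≤ x ⬝ᵥ phess h (r μ) *ᵥ x := by
    have := hLMB (r μ) (hr μ) x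
    rw [sum_sum_mul_eq_dotProduct_mulVec] at this
    simpa [dotProduct, sq] using this
  have hpd (μ) : (phess h (r μ)).PosDef :=
    posDef_of_mul_dotProduct_le (phess_isSymm (hC2at μ)) (hcpos μ) (hlow μ)
  have hrC1 : ContDiff ℝ 1 r := contDiff_iff_contDiffAt.2 fun μ =>
    contDiffAt_of_pgrad_rightInverse hC2 (injOn_pgrad hd hSC) hr hgr (hpd μ).isUnit
  have hrd : Differentiable ℝ r := hrC1.differentiable one_ne_zero
  have hstar_eq : hstar h = fun ν => ν ⬝ᵥ r ν - h (r ν) := by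
    ext ν
    have := hstar_pgrad hd hconv (hr ν)
    rwa [hgr] at this
  have hderiv (μ) : HasFDerivAt (hstar h) _ μ :=
    hstar_eq ▸ hasFDerivAt_conjugate ((hC2at μ).differentiableAt two_ne_zero) (hrd μ) (hgr μ)
  have hgrad : pgrad (hstar h) = r := funext fun μ => pgrad_eq_of_hasFDerivAt (hderiv μ)
  have hC : ContDiff ℝ 2 (hstar h) :=
    contDiff_two_of_pgrad (fun μ => (hderiv μ).differentiableAt) (hgrad ▸ hrC1)
  have hmul (μ) : phess (hstar h) μ * phess h (r μ) = 1 := by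
    have hGd := (contDiffAt_pgrad (hC2at μ)).differentiableAt one_ne_zero
    have hcomp := hGd.hasFDerivAt.comp μ (hrd μ).hasFDerivAt
    rw [show pgrad h ∘ r = id from funext hgr] at hcomp
    have huniq := hcomp.unique (hasFDerivAt_id μ)
    rw [← transpose_inj, transpose_mul, transpose_one, ← Matrix.mulVec_injective.eq_iff]
    ext1 v
    rw [← mulVec_mulVec, ← fderiv_pgrad (h := hstar h) (hgrad ▸ hrd μ), hgrad, ← fderiv_pgrad hGd,
      one_mulVec]
    exact congrArg (fun T => T v) huniq
  have hmul' (μ) : phess h (r μ) * phess (hstar h) μ = 1 := mul_eq_one_comm.1 (hmul μ)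
  have hpd' (μ) : (phess (hstar h) μ).PosDef := by
    rw [← Matrix.inv_eq_right_inv (hmul' μ)]
    exact (hpd μ).inv
  rw [hgrad]
  refine ⟨hC, fun μ => ⟨hmul' μ, hmul μ, phess_isSymm hC.contDiffAt, hpd' μ⟩, fun R hR μ hRμ => ?_⟩
  have hup (x) : x ⬝ᵥ phess (hstar h) μ *ᵥ x ≤ R / (K * θ) * (x ⬝ᵥ x) := by
    have h1 := mul_dotProduct_mulVec_le_of_mul_eq_one (hcpos μ) (hlow μ) (hmul' μ) x
    have h2 : 0 ≤ x ⬝ᵥ x := by simpa using dotProduct_star_self_nonneg x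
    have hKθ := mul_pos hK hθ
    rw [div_mul_eq_mul_div, div_le_iff₀ (rbar_pos hN (hr μ))] at h1
    rw [div_mul_eq_mul_div, le_div_iff₀ hKθ]
    nlinarith [mul_le_mul_of_nonneg_left hRμ h2]
  refine ⟨fun x => ?_, abs_apply_le_of_dotProduct_mulVec_le (hpd' μ).posSemidef hup⟩
  rw [sum_sum_mul_eq_dotProduct_mulVec]
  simpa [dotProduct, sq] using hup x
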